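/- Let U be concave differentiable with derivative L and inverse marginal utility f = L⁻¹, let π⁺ ≥ π⁻ ≥ 0, and let d⁺ = f(π⁺), d⁻ = f(π⁻) (assuming both lie in the feasible interval). For r ∈ ℝ, define the benchmark surplus S_b(r) = U(d⁺) - π⁺·(d⁺ - r) when r ≤ d⁺ and the community surplus at price π⁻, S_c(r) = U(d⁻) - π⁻·(d⁻ - r). Then for r ≤ d⁺: S_c(r) - S_b(r) = U(d⁻) - π⁻·(d⁻ - r) - U(d⁺) + π⁺·(d⁺ - r) ≥ (π⁺ - π⁻)·(d⁺ - r) ≥ 0. -/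

import Mathlib

/-- Individual rationality, Case 15: with concave differentiable `U`
(derivative `L`), `π⁺ ≥ π⁻ ≥ 0`, `L d⁺ = π⁺`, `L d⁻ = π⁻`, and `r ≤ d⁺`, the
surplus gain of trading at `π⁻` over the benchmark buying at `π⁺` is at least
`(π⁺ - π⁻)(d⁺ - r) ≥ 0`. -/
theorem stmt_10 (U L : ℝ → ℝ) (πp πm dp dm r : ℝ)
    (hU : ConcaveOn ℝ Set.univ U)
    (hL : ∀ x : ℝ, HasDerivAt U (L x) x)
    (hπm : 0 ≤ πm) (hπ : πm ≤ πp)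
    (hdp : L dp = πp) (hdm : L dm = πm)
    (hr : r ≤ dp) :
    U dm - πm * (dm - r) - U dp + πp * (dp - r) ≥ (πp - πm) * (dp - r) ∧
    (πp - πm) * (dp - r) ≥ 0 := by
  have key : U dp ≤ U dm + πm * (dp - dm) := by
    have hd := hL dm
    rw [hdm] at hd
    rcases lt_trichotomy dp dm with h | h | h
    · have h1 := hU.le_slope_of_hasDerivAt (Set.mem_univ dp) (Set.mem_univ dm) h hd
      rw [slope_def_field, le_div_iff₀ (by linarith)] at h1
      linarith
    · subst h
      simp
    · have h1 := hU.slope_le_of_hasDerivAt (Set.mem_univ dm) (Set.mem_univ dp) h hd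
      rw [slope_def_field, div_le_iff₀ (by linarith)] at h1
      linarith
  refine ⟨by linarith, mul_nonneg (by linarith) (by linarith)⟩
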